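/- Serializing two branches at a fork is non-increasing in risk: let B₁ be a chain with probabilities p : Fin m → [0,1] and costs c : Fin m → ℝ≥0, and B₂ a chain with probabilities q : Fin k → [0,1] and costs d : Fin k → ℝ≥0. Then the risk of the concatenated chain B₁ ++ B₂ is at most the sum of the risks of the two branches taken separately from the same fork: risk(B₁ ++ B₂) ≤ risk(B₁) + risk(B₂). -/

import Mathlib

theorem Fin.prod_Iic_castAdd_append {M : Type*} [CommMonoid M] {m k : ℕ}
    (p : Fin m → M) (q : Fin k → M) (i : Fin m) :
    ∏ j ∈ Finset.Iic (Fin.castAdd k i), Fin.append p q j = ∏ j ∈ Finset.Iic i, p j := by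
  have h (j : Fin k) : ¬ Fin.natAdd m j ≤ Fin.castAdd k i := by
    simp only [Fin.le_def, Fin.val_natAdd, Fin.val_castAdd]
    omega
  simp only [← Finset.filter_ge_eq_Iic, Finset.prod_filter, Fin.prod_univ_add,
    Fin.append_left, Fin.append_right, h, if_false, Finset.prod_const_one, mul_one]
  simp only [Fin.le_def, Fin.val_castAdd]

theorem Fin.prod_Iic_natAdd_append {M : Type*} [CommMonoid M] {m k : ℕ}
    (p : Fin m → M) (q : Fin k → M) (i : Fin k) :
    ∏ j ∈ Finset.Iic (Fin.natAdd m i), Fin.append p q j =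
      (∏ j, p j) * ∏ j ∈ Finset.Iic i, q j := by
  have h (j : Fin m) : Fin.castAdd k j ≤ Fin.natAdd m i := by
    simp only [Fin.le_def, Fin.val_natAdd, Fin.val_castAdd]
    omega
  simp only [← Finset.filter_ge_eq_Iic, Finset.prod_filter, Fin.prod_univ_add,
    Fin.append_left, Fin.append_right, h, if_true]
  simp only [Fin.le_def, Fin.val_natAdd, Nat.add_le_add_iff_left]


/-- Serializing two branches at a fork is non-increasing in risk: the risk of the
concatenated chain `B₁ ++ B₂` is at most the sum of the risks of the two branches
taken separately from the same fork. -/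
theorem risk_concat_le_sum {m k : ℕ} (p : Fin m → ℝ) (c : Fin m → NNReal)
    (q : Fin k → ℝ) (d : Fin k → NNReal)
    (hp : ∀ i, p i ∈ Set.Icc (0 : ℝ) 1) (hq : ∀ i, q i ∈ Set.Icc (0 : ℝ) 1) :
    ∑ i : Fin (m + k),
        (Fin.append (fun i => (c i : ℝ)) (fun i => (d i : ℝ)) i) *
          ∏ j ∈ Finset.Iic i, Fin.append p q j
      ≤ (∑ i : Fin m, (c i : ℝ) * ∏ j ∈ Finset.Iic i, p j)
        + ∑ i : Fin k, (d i : ℝ) * ∏ j ∈ Finset.Iic i, q j := by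
  simp only [Fin.sum_univ_add, Fin.append_left, Fin.append_right,
    Fin.prod_Iic_castAdd_append, Fin.prod_Iic_natAdd_append]
  gcongr with i
  exact mul_le_of_le_one_left (Finset.prod_nonneg fun j _ => (hq j).1)
    (Finset.prod_le_one (fun j _ => (hp j).1) fun j _ => (hp j).2)
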